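/- Let ρ = (ρ, ρU, ρE) ∈ ℝ × ℝ^D × ℝ and α ∈ 𝒟. Then α satisfies the moment equations Σ_{m=1}^N ∫_ℝ m_m(ξ) exp(α · m_m(ξ)) dξ = ρ if and only if α minimizes J over 𝒟, i.e. J(α) ≤ J(β) for all β ∈ 𝒟. -/

import Mathlib

open scoped RealInnerProductSpace
open MeasureTheory

/-- The function `J(α) = Σ_m √(2π/(−α_{D+1})) exp(α₀ + ⟪α̂, l m⟫²/(2(−α_{D+1})))
− (ρ α₀ + ρU·α̂ + ρE α_{D+1})`, for `ρ = (r, rU, rE) ∈ ℝ × ℝᴰ × ℝ` and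
`α = (α₀, α̂, α_{D+1})`. -/
noncomputable def Jfun {D N : ℕ} (l : Fin N → EuclideanSpace ℝ (Fin D))
    (r : ℝ) (rU : EuclideanSpace ℝ (Fin D)) (rE : ℝ)
    (α : ℝ × EuclideanSpace ℝ (Fin D) × ℝ) : ℝ :=
  (∑ m, Real.sqrt (2 * Real.pi / (-α.2.2)) *
      Real.exp (α.1 + ⟪α.2.1, l m⟫ ^ 2 / (2 * (-α.2.2))))
    - (r * α.1 + ⟪rU, α.2.1⟫ + rE * α.2.2)

/-- `s_min(e) = inf { Σ_m |a_m| : Σ_m a_m l_m = e }`. -/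
noncomputable def smin {D N : ℕ} (l : Fin N → EuclideanSpace ℝ (Fin D))
    (e : EuclideanSpace ℝ (Fin D)) : ℝ :=
  sInf {s : ℝ | ∃ a : Fin N → ℝ, (∑ m, a m • l m) = e ∧ s = ∑ m, |a m|}

/-- The discrete equilibrium ansatz `𝓔_m(ξ) = exp (α ⬝ m_m ξ)`. -/
noncomputable def discEquil {D : ℕ} (lm : EuclideanSpace ℝ (Fin D))
    (α : ℝ × EuclideanSpace ℝ (Fin D) × ℝ) (ξ : ℝ) : ℝ :=
  Real.exp (α.1 + ξ * ⟪α.2.1, lm⟫ + ξ ^ 2 / 2 * α.2.2)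

theorem exp_quadratic_eq (a b : ℝ) {c : ℝ} (hc : c < 0) (ξ : ℝ) :
    Real.exp (a + ξ * b + ξ ^ 2 / 2 * c) =
      Real.exp (-(-c / 2) * (ξ - b / (-c)) ^ 2) * Real.exp (a + b ^ 2 / (2 * (-c))) := by
  have hc' : c ≠ 0 := hc.ne
  rw [← Real.exp_add]
  congr 1
  field_simp
  ring

theorem integrable_exp_quadratic (a b : ℝ) {c : ℝ} (hc : c < 0) :
    Integrable fun ξ : ℝ => Real.exp (a + ξ * b + ξ ^ 2 / 2 * c) := by
  simp_rw [exp_quadratic_eq a b hc]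
  exact ((integrable_exp_neg_mul_sq (show 0 < -c / 2 by linarith)).comp_sub_right _).mul_const _

theorem integral_exp_quadratic (a b : ℝ) {c : ℝ} (hc : c < 0) :
    ∫ ξ : ℝ, Real.exp (a + ξ * b + ξ ^ 2 / 2 * c) =
      Real.sqrt (2 * Real.pi / (-c)) * Real.exp (a + b ^ 2 / (2 * (-c))) := by
  simp_rw [exp_quadratic_eq a b hc]
  rw [integral_mul_const,
    integral_sub_right_eq_self (fun ξ : ℝ => Real.exp (-(-c / 2) * ξ ^ 2)) (b / (-c)),
    integral_gaussian]
  congr 2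
  have hc' : c ≠ 0 := hc.ne
  field_simp

/-- A continuous weight dominated by `exp ξ + exp (-ξ)` is integrable against `exp` of a
quadratic with negative leading coefficient. -/
theorem integrable_mul_exp_quadratic {w : ℝ → ℝ} (hw : Continuous w)
    (hle : ∀ ξ, |w ξ| ≤ Real.exp ξ + Real.exp (-ξ)) (a b : ℝ) {c : ℝ} (hc : c < 0) :
    Integrable fun ξ : ℝ => w ξ * Real.exp (a + ξ * b + ξ ^ 2 / 2 * c) := by
  refine ((integrable_exp_quadratic a (b + 1) hc).add
    (integrable_exp_quadratic a (b - 1) hc)).mono' (by fun_prop) (.of_forall fun ξ => ?_)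
  rw [Real.norm_eq_abs, abs_mul, Real.abs_exp]
  refine (mul_le_mul_of_nonneg_right (hle ξ) (Real.exp_pos _).le).trans_eq ?_
  simp only [Pi.add_apply, add_mul, ← Real.exp_add]
  ring_nf

theorem abs_le_exp_add_exp_neg (ξ : ℝ) : |ξ| ≤ Real.exp ξ + Real.exp (-ξ) := by
  have := Real.add_one_le_exp ξ
  have := Real.add_one_le_exp (-ξ)
  have := Real.exp_pos ξ
  have := Real.exp_pos (-ξ)
  rw [abs_le]
  constructor <;> linarith

theorem abs_sq_div_two_le_exp_add_exp_neg (ξ : ℝ) :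
    |ξ ^ 2 / 2| ≤ Real.exp ξ + Real.exp (-ξ) := by
  have hp := Real.exp_pos ξ
  have hn := Real.exp_pos (-ξ)
  rw [abs_of_nonneg (by positivity)]
  rcases le_total 0 ξ with h | h
  · linarith [Real.quadratic_le_exp_of_nonneg h]
  · linarith [Real.quadratic_le_exp_of_nonneg (neg_nonneg.2 h), neg_sq ξ]

section

variable {D N : ℕ}

theorem integrable_discEquil (e : EuclideanSpace ℝ (Fin D))
    {α : ℝ × EuclideanSpace ℝ (Fin D) × ℝ} (hα : α.2.2 < 0) : Integrable (discEquil e α) :=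
  integrable_exp_quadratic _ _ hα

theorem integrable_id_mul_discEquil (e : EuclideanSpace ℝ (Fin D))
    {α : ℝ × EuclideanSpace ℝ (Fin D) × ℝ} (hα : α.2.2 < 0) :
    Integrable fun ξ : ℝ => ξ * discEquil e α ξ :=
  integrable_mul_exp_quadratic continuous_id abs_le_exp_add_exp_neg _ _ hα

theorem integrable_sq_div_two_mul_discEquil (e : EuclideanSpace ℝ (Fin D))
    {α : ℝ × EuclideanSpace ℝ (Fin D) × ℝ} (hα : α.2.2 < 0) :
    Integrable fun ξ : ℝ => ξ ^ 2 / 2 * discEquil e α ξ :=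
  integrable_mul_exp_quadratic (w := fun ξ => ξ ^ 2 / 2) (by fun_prop)
    abs_sq_div_two_le_exp_add_exp_neg _ _ hα

theorem Jfun_eq_sum_integral (l : Fin N → EuclideanSpace ℝ (Fin D)) (r : ℝ)
    (rU : EuclideanSpace ℝ (Fin D)) (rE : ℝ) {α : ℝ × EuclideanSpace ℝ (Fin D) × ℝ}
    (hα : α.2.2 < 0) :
    Jfun l r rU rE α = (∑ m, ∫ ξ, discEquil (l m) α ξ)
      - (r * α.1 + ⟪rU, α.2.1⟫ + rE * α.2.2) := by
  simp only [Jfun, discEquil, integral_exp_quadratic _ _ hα]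

/-- The integrated tangent-line inequality for `exp`. -/
theorem integral_discEquil_add_le (e : EuclideanSpace ℝ (Fin D))
    {α β : ℝ × EuclideanSpace ℝ (Fin D) × ℝ} (hα : α.2.2 < 0) (hβ : β.2.2 < 0) :
    (∫ ξ, discEquil e α ξ) + ((β.1 - α.1) * (∫ ξ, discEquil e α ξ)
      + ⟪β.2.1 - α.2.1, e⟫ * (∫ ξ, ξ * discEquil e α ξ)
      + (β.2.2 - α.2.2) * (∫ ξ, ξ ^ 2 / 2 * discEquil e α ξ)) ≤ ∫ ξ, discEquil e β ξ := by
  have h0 := integrable_discEquil e hα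
  have h1 := (integrable_id_mul_discEquil e hα).const_mul ⟪β.2.1 - α.2.1, e⟫
  have h2 := (integrable_sq_div_two_mul_discEquil e hα).const_mul (β.2.2 - α.2.2)
  have h0' := h0.const_mul (β.1 - α.1)
  simp only [← integral_const_mul]
  rw [← integral_add' h0' h1, ← integral_add' (h0'.add h1) h2,
    ← integral_add' h0 ((h0'.add h1).add h2)]
  refine integral_mono (h0.add ((h0'.add h1).add h2)) (integrable_discEquil e hβ) fun ξ => ?_
  simp only [Pi.add_apply, discEquil, inner_sub_left]
  set x := α.1 + ξ * ⟪α.2.1, e⟫ + ξ ^ 2 / 2 * α.2.2 with hx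
  set y := β.1 + ξ * ⟪β.2.1, e⟫ + ξ ^ 2 / 2 * β.2.2 with hy
  have hexp : Real.exp y = Real.exp x * Real.exp (y - x) := by
    rw [← Real.exp_add, add_sub_cancel]
  have hmul := mul_le_mul_of_nonneg_left (Real.add_one_le_exp (y - x)) (Real.exp_pos x).le
  rw [← hexp] at hmul
  refine le_trans (le_of_eq ?_) hmul
  rw [hx, hy]
  ring

theorem Jfun_le_of_moments_eq {l : Fin N → EuclideanSpace ℝ (Fin D)} {r rE : ℝ}
    {rU : EuclideanSpace ℝ (Fin D)} {α β : ℝ × EuclideanSpace ℝ (Fin D) × ℝ}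
    (hα : α.2.2 < 0) (hβ : β.2.2 < 0)
    (h0 : (∑ m, ∫ ξ : ℝ, discEquil (l m) α ξ) = r)
    (h1 : (∑ m, (∫ ξ : ℝ, ξ * discEquil (l m) α ξ) • l m) = rU)
    (h2 : (∑ m, ∫ ξ : ℝ, ξ ^ 2 / 2 * discEquil (l m) α ξ) = rE) :
    Jfun l r rU rE α ≤ Jfun l r rU rE β := by
  rw [Jfun_eq_sum_integral l r rU rE hα, Jfun_eq_sum_integral l r rU rE hβ]
  have hsum := Finset.sum_le_sum fun m (_ : m ∈ Finset.univ) =>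
    integral_discEquil_add_le (l m) hα hβ
  have hinner : ∑ m, ⟪β.2.1 - α.2.1, l m⟫ * (∫ ξ, ξ * discEquil (l m) α ξ)
      = ⟪rU, β.2.1⟫ - ⟪rU, α.2.1⟫ := by
    rw [← inner_sub_right, ← h1, sum_inner]
    refine Finset.sum_congr rfl fun m _ => ?_
    rw [real_inner_smul_left, real_inner_comm, mul_comm]
  simp only [Finset.sum_add_distrib, ← Finset.mul_sum] at hsum
  rw [hinner, h0, h2] at hsum
  rw [h0]
  linarith

theorem differentiableAt_Jfun_line (l : Fin N → EuclideanSpace ℝ (Fin D)) (r : ℝ)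
    (rU : EuclideanSpace ℝ (Fin D)) (rE : ℝ) {α : ℝ × EuclideanSpace ℝ (Fin D) × ℝ}
    (hα : α.2.2 < 0) (v : ℝ × EuclideanSpace ℝ (Fin D) × ℝ) :
    DifferentiableAt ℝ (fun t : ℝ => Jfun l r rU rE (α + t • v)) 0 := by
  simp only [Jfun, Prod.fst_add, Prod.snd_add, Prod.smul_fst, Prod.smul_snd, smul_eq_mul,
    inner_add_left, inner_add_right, real_inner_smul_left, real_inner_smul_right]
  fun_prop (disch := simp [hα.ne, Real.pi_ne_zero])

theorem deriv_Jfun_line_eq_zero {l : Fin N → EuclideanSpace ℝ (Fin D)} {r rE : ℝ}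
    {rU : EuclideanSpace ℝ (Fin D)} {α : ℝ × EuclideanSpace ℝ (Fin D) × ℝ} (hα : α.2.2 < 0)
    (hmin : ∀ β : ℝ × EuclideanSpace ℝ (Fin D) × ℝ, β.2.2 < 0 →
      Jfun l r rU rE α ≤ Jfun l r rU rE β) (v : ℝ × EuclideanSpace ℝ (Fin D) × ℝ) :
    deriv (fun t : ℝ => Jfun l r rU rE (α + t • v)) 0 = 0 := by
  refine IsLocalMin.deriv_eq_zero ?_
  have hcont : ContinuousAt (fun t : ℝ => (α + t • v).2.2) 0 := by fun_prop
  filter_upwards [hcont.eventually_lt_const (by simpa using hα)] with t ht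
  simpa using hmin _ ht

/-- If the same point minimizes `Jfun` for two data, the data pair equally with every
direction. -/
theorem pairing_eq_of_minimizes {l : Fin N → EuclideanSpace ℝ (Fin D)} {r s rE sE : ℝ}
    {rU sU : EuclideanSpace ℝ (Fin D)} {α : ℝ × EuclideanSpace ℝ (Fin D) × ℝ}
    (hα : α.2.2 < 0)
    (hr : ∀ β : ℝ × EuclideanSpace ℝ (Fin D) × ℝ, β.2.2 < 0 →
      Jfun l r rU rE α ≤ Jfun l r rU rE β)
    (hs : ∀ β : ℝ × EuclideanSpace ℝ (Fin D) × ℝ, β.2.2 < 0 →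
      Jfun l s sU sE α ≤ Jfun l s sU sE β)
    (v : ℝ × EuclideanSpace ℝ (Fin D) × ℝ) :
    (s - r) * v.1 + ⟪sU - rU, v.2.1⟫ + (sE - rE) * v.2.2 = 0 := by
  have hdr := (differentiableAt_Jfun_line l r rU rE hα v).hasDerivAt
  have hds := (differentiableAt_Jfun_line l s sU sE hα v).hasDerivAt
  rw [deriv_Jfun_line_eq_zero hα hr v] at hdr
  rw [deriv_Jfun_line_eq_zero hα hs v] at hds
  have hlin : HasDerivAt (fun t : ℝ => Jfun l r rU rE α - Jfun l s sU sE α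
      + t * ((s - r) * v.1 + ⟪sU - rU, v.2.1⟫ + (sE - rE) * v.2.2)) 0 0 := by
    convert! hdr.sub hds using 1
    · funext t
      simp only [Pi.sub_apply, Jfun, Prod.fst_add, Prod.snd_add, Prod.smul_fst, Prod.smul_snd,
        smul_eq_mul, inner_add_right, inner_sub_left, real_inner_smul_right]
      ring
    · simp
  have hlin' := ((hasDerivAt_id (0 : ℝ)).mul_const
    ((s - r) * v.1 + ⟪sU - rU, v.2.1⟫ + (sE - rE) * v.2.2)).const_add
      (Jfun l r rU rE α - Jfun l s sU sE α)
  simpa using hlin'.unique hlin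

end

/-- `α ∈ 𝒟` satisfies the moment equations
`Σ_m ∫ m_m(ξ) exp(α ⬝ m_m(ξ)) dξ = ρ` iff `α` minimizes `J` over `𝒟`. -/
theorem stmt_4
    (D N : ℕ) (hD : 2 ≤ D) (hN : D ≤ N)
    (l : Fin N → EuclideanSpace ℝ (Fin D)) (hl : ∀ m, ‖l m‖ = 1)
    (hrank : Submodule.span ℝ (Set.range l) = ⊤)
    (r rE : ℝ) (rU : EuclideanSpace ℝ (Fin D))
    (α : ℝ × EuclideanSpace ℝ (Fin D) × ℝ) (hα : α.2.2 < 0) :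
    ((∑ m, ∫ ξ : ℝ, discEquil (l m) α ξ) = r ∧
        (∑ m, (∫ ξ : ℝ, ξ * discEquil (l m) α ξ) • l m) = rU ∧
        (∑ m, ∫ ξ : ℝ, ξ ^ 2 / 2 * discEquil (l m) α ξ) = rE)
      ↔ ∀ β : ℝ × EuclideanSpace ℝ (Fin D) × ℝ, β.2.2 < 0 →
          Jfun l r rU rE α ≤ Jfun l r rU rE β := by
  constructor
  · rintro ⟨h0, h1, h2⟩ β hβ
    exact Jfun_le_of_moments_eq hα hβ h0 h1 h2
  · intro hmin
    have key := pairing_eq_of_minimizes hα hmin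
      fun β hβ => Jfun_le_of_moments_eq hα hβ rfl rfl rfl
    refine ⟨?_, ?_, ?_⟩
    · exact sub_eq_zero.1 (by simpa using key (1, 0, 0))
    · exact ext_inner_right ℝ fun u =>
        sub_eq_zero.1 (by simpa [inner_sub_left] using key (0, u, 0))
    · exact sub_eq_zero.1 (by simpa using key (0, 0, 1))
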